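/- Let A be a C*-algebra, M(A) its multiplier algebra, and let Ã ⊆ M(A) be the smallest unital C*-subalgebra of M(A) containing the canonical image of A (the minimal unitization of A). Let u ∈ M(A) be a unitary lying in the path component of the identity in the unitary group of M(A) with the norm topology. Then for every finite subset F ⊆ A and every ε > 0 there exists a unitary v ∈ Ã, lying in the path component of the identity in the unitary group of Ã with the norm topology, such that ‖(u − v)·b‖ < ε and ‖b·(u − v)‖ < ε for all b ∈ F. In other words, the identity component of the unitary group of the minimal unitization is strictly dense in the identity component of the unitary group of M(A). -/

import Mathlib

open scoped MultiplierAlgebra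

section LeftStrict

open Filter Topology

/-- The family `f` is eventually norm-bounded along `l` and converges to `x` in the topology of
pointwise convergence of left multiplication on `J`. -/
structure TendstoLeftStrict {ι R : Type*} [NormedRing R] (J : Set R) (f : ι → R) (l : Filter ι)
    (x : R) : Prop where
  eventually_norm_le : ∃ C, ∀ᶠ i in l, ‖f i‖ ≤ C
  tendsto_mul : ∀ a ∈ J, Tendsto (fun i ↦ f i * a) l (𝓝 (x * a))

namespace TendstoLeftStrict

variable {ι R : Type*} [NormedRing R] {J : Set R} {l : Filter ι} {f g : ι → R} {x y : R}

lemma const (x : R) : TendstoLeftStrict J (fun _ : ι ↦ x) l x :=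
  ⟨⟨‖x‖, .of_forall fun _ ↦ le_rfl⟩, fun _ _ ↦ tendsto_const_nhds⟩

lemma mul (hf : TendstoLeftStrict J f l x) (hg : TendstoLeftStrict J g l y)
    (hy : ∀ a ∈ J, y * a ∈ J) :
    TendstoLeftStrict J (fun i ↦ f i * g i) l (x * y) := by
  obtain ⟨C, hC⟩ := hf.eventually_norm_le
  obtain ⟨D, hD⟩ := hg.eventually_norm_le
  refine ⟨⟨C * D, ?_⟩, fun a ha ↦ ?_⟩
  · filter_upwards [hC, hD] with i hi hi'
    exact (norm_mul_le _ _).trans (by gcongr; exact (norm_nonneg _).trans hi)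
  · have hbdd : IsBoundedUnder (· ≤ ·) l (norm ∘ f) := ⟨C, by simpa using hC⟩
    have h₁ : Tendsto (fun i ↦ g i * a - y * a) l (𝓝 0) := by
      simpa using (hg.tendsto_mul a ha).sub_const (y * a)
    have h₂ := (isBoundedUnder_le_mul_tendsto_zero hbdd h₁).add (hf.tendsto_mul _ (hy a ha))
    simpa [mul_sub, mul_assoc] using h₂

lemma pow (hf : TendstoLeftStrict J f l x) (hx : ∀ a ∈ J, x * a ∈ J) (n : ℕ) :
    TendstoLeftStrict J (fun i ↦ f i ^ n) l (x ^ n) := by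
  induction n with
  | zero => simpa using const 1
  | succ n ih => simpa only [pow_succ] using ih.mul hf hx

lemma const_smul [NormedAlgebra ℂ R] (c : ℂ) (hf : TendstoLeftStrict J f l x) :
    TendstoLeftStrict J (fun i ↦ c • f i) l (c • x) := by
  obtain ⟨C, hC⟩ := hf.eventually_norm_le
  refine ⟨⟨‖c‖ * C, ?_⟩, fun a ha ↦ ?_⟩
  · filter_upwards [hC] with i hi
    rw [norm_smul]
    gcongr
  · simpa using (hf.tendsto_mul a ha).const_smul c

/-- The exponential is continuous on bounded sets for pointwise convergence of left
multiplication. -/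
lemma tendsto_exp_mul [NormedAlgebra ℂ R] [CompleteSpace R] (hf : TendstoLeftStrict J f l x)
    (hx : ∀ a ∈ J, x * a ∈ J) {a : R} (ha : a ∈ J) :
    Tendsto (fun i ↦ NormedSpace.exp (f i) * a) l (𝓝 (NormedSpace.exp x * a)) := by
  obtain ⟨C, hC⟩ := hf.eventually_norm_le
  have exp_mul_eq (z : R) :
      NormedSpace.exp z * a = ∑' n : ℕ, (n.factorial⁻¹ : ℂ) • (z ^ n * a) := by
    rw [NormedSpace.exp_eq_tsum ℂ]
    simp only [← smul_mul_assoc]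
    exact ((NormedSpace.expSeries_summable' (𝕂 := ℂ) z).tsum_mul_right a).symm
  simp only [exp_mul_eq]
  refine tendsto_tsum_of_dominated_convergence (bound := fun n ↦ C ^ n / n.factorial * ‖a‖)
    ((Real.summable_pow_div_factorial C).mul_right _)
    (fun n ↦ ((hf.pow hx n).tendsto_mul a ha).const_smul _) ?_
  filter_upwards [hC] with i hi n
  have norm_pow_mul_le : ‖f i ^ n * a‖ ≤ C ^ n * ‖a‖ := by
    induction n with
    | zero => simp
    | succ n ih =>
      rw [pow_succ', mul_assoc, pow_succ', mul_assoc]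
      exact (norm_mul_le _ _).trans (by gcongr; exact (norm_nonneg _).trans hi)
  calc ‖(n.factorial⁻¹ : ℂ) • (f i ^ n * a)‖
      = ‖f i ^ n * a‖ / n.factorial := by simp [norm_smul, div_eq_inv_mul]
    _ ≤ C ^ n * ‖a‖ / n.factorial := by gcongr
    _ = C ^ n / n.factorial * ‖a‖ := by ring

end TendstoLeftStrict

end LeftStrict

section Multiplier

open Filter Topology DoubleCentralizer selfAdjoint

variable {A : Type*} [NonUnitalCStarAlgebra A]

lemma DoubleCentralizer.mul_coe (m : 𝓜(ℂ, A)) (a : A) :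
    m * (a : 𝓜(ℂ, A)) = (m.fst a : A) := by
  ext b
  · have h (c : A) : c * m.fst (a * b) = c * (m.fst a * b) := by
      rw [← m.central, ← mul_assoc, m.central, mul_assoc]
    change m.fst (a * b) = m.fst a * b
    rw [← sub_eq_zero, ← CStarRing.star_mul_self_eq_zero_iff, mul_sub, h, sub_self]
  · simp [m.central]

lemma DoubleCentralizer.norm_coe (a : A) : ‖(a : 𝓜(ℂ, A))‖ = ‖a‖ := by
  rw [← norm_fst, coe_fst, ContinuousLinearMap.opNorm_mul_apply]

lemma DoubleCentralizer.star_coe (a : A) : star (a : 𝓜(ℂ, A)) = (star a : A) :=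
  (map_star (coeHom (𝕜 := ℂ)) a).symm

lemma DoubleCentralizer.coe_mul_mem_range (a : A) (m : 𝓜(ℂ, A)) :
    (a : 𝓜(ℂ, A)) * m ∈ Set.range ((↑) : A → 𝓜(ℂ, A)) :=
  ⟨star ((star m).fst (star a)), by rw [← star_coe, ← mul_coe, ← star_coe]; simp⟩

lemma DoubleCentralizer.mul_mem_range (m : 𝓜(ℂ, A)) :
    ∀ a ∈ Set.range ((↑) : A → 𝓜(ℂ, A)), m * a ∈ Set.range ((↑) : A → 𝓜(ℂ, A)) := by
  rintro _ ⟨a, rfl⟩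
  exact ⟨_, (mul_coe m a).symm⟩

variable (A) in
/-- Every C⋆-algebra has a selfadjoint approximate unit which converges strictly to `1`
in the multiplier algebra. -/
lemma exists_tendstoLeftStrict_coe_one :
    ∃ l : Filter A, l.NeBot ∧ (∀ᶠ e in l, IsSelfAdjoint e) ∧
      TendstoLeftStrict (Set.range ((↑) : A → 𝓜(ℂ, A))) ((↑) : A → 𝓜(ℂ, A)) l 1 := by
  let _ := CStarAlgebra.spectralOrder A
  have := CStarAlgebra.spectralOrderedRing A
  have h := CStarAlgebra.increasingApproximateUnit A
  refine ⟨_, h.neBot, h.eventually_isSelfAdjoint, ⟨1, ?_⟩, ?_⟩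
  · simpa only [norm_coe] using h.eventually_norm
  · rintro _ ⟨a, rfl⟩
    have hc : Isometry (coeHom (𝕜 := ℂ) (A := A)) :=
      AddMonoidHomClass.isometry_of_norm _ norm_coe
    simpa [Function.comp_def, -coeHom_apply, ← coeHom_apply] using
      (hc.continuous.tendsto a).comp (h.tendsto_mul_right a)

/-- The unitaries in a unital star subalgebra, as a submonoid. -/
def StarSubalgebra.unitarySubmonoid {B : Type*} [CStarAlgebra B] (S : StarSubalgebra ℂ B) :
    Submonoid B :=
  S.toSubalgebra.toSubmonoid ⊓ unitary B

lemma StarSubalgebra.joinedIn_one_exp {B : Type*} [CStarAlgebra B] {S : StarSubalgebra ℂ B}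
    (hS : IsClosed (S : Set B)) {x : B} (hx : x ∈ S) (hx' : IsSelfAdjoint x) :
    JoinedIn (S.unitarySubmonoid : Set B) 1 (NormedSpace.exp (Complex.I • x)) := by
  let y : selfAdjoint B := ⟨x, hx'⟩
  let _ : NormedAlgebra ℚ B := .restrictScalars ℚ ℂ B
  refine ⟨((expUnitaryPathToOne y).map continuous_subtype_val).cast (by simp) (by simp [y]),
    fun t ↦ ⟨?_, (expUnitaryPathToOne y t).2⟩⟩
  exact NormedSpace.exp_mem (R := ℂ) hS
    (S.smul_mem (x := (t : ℝ) • x) (by simpa using S.smul_mem hx ((t : ℝ) : ℂ)) Complex.I)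

/-- A product of exponential unitaries in the multiplier algebra is a strict limit of unitaries
in the identity component of any closed unital star subalgebra containing `A`. -/
lemma exists_tendstoLeftStrict_unitary {S : StarSubalgebra ℂ 𝓜(ℂ, A)}
    (hS : IsClosed (S : Set 𝓜(ℂ, A))) (hAS : Set.range ((↑) : A → 𝓜(ℂ, A)) ⊆ S)
    {l : Filter A} (hl : ∀ᶠ e in l, IsSelfAdjoint e)
    (hl₁ : TendstoLeftStrict (Set.range ((↑) : A → 𝓜(ℂ, A))) ((↑) : A → 𝓜(ℂ, A)) l 1)
    (L : List (selfAdjoint 𝓜(ℂ, A))) :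
    ∃ v : A → 𝓜(ℂ, A), (∀ᶠ e in l, JoinedIn (S.unitarySubmonoid : Set 𝓜(ℂ, A)) 1 (v e)) ∧
      TendstoLeftStrict (Set.range ((↑) : A → 𝓜(ℂ, A))) v l
        ((L.map expUnitary).prod : unitary 𝓜(ℂ, A)) := by
  induction L with
  | nil =>
    exact ⟨1, .of_forall fun _ ↦ .refl (one_mem S.unitarySubmonoid), by simpa using! .const 1⟩
  | cons x L ih =>
    obtain ⟨v, hv, hv'⟩ := ih
    let X : A → 𝓜(ℂ, A) := fun e ↦ e * x * e
    have hX : TendstoLeftStrict (Set.range ((↑) : A → 𝓜(ℂ, A))) X l x := by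
      simpa using (hl₁.mul (.const (x : 𝓜(ℂ, A))) (mul_mem_range _)).mul hl₁ (mul_mem_range 1)
    have hexp : ∀ᶠ e in l, JoinedIn (S.unitarySubmonoid : Set 𝓜(ℂ, A)) 1
        (NormedSpace.exp (Complex.I • X e)) := by
      filter_upwards [hl] with e he
      refine S.joinedIn_one_exp hS (hAS ?_) ?_
      · simpa only [X, mul_assoc] using coe_mul_mem_range e _
      · have : star (e : 𝓜(ℂ, A)) = e := by rw [star_coe, he.star_eq]
        simp [X, isSelfAdjoint_iff, this, mul_assoc, x.2.star_eq]
    have hlim : TendstoLeftStrict (Set.range ((↑) : A → 𝓜(ℂ, A)))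
        (fun e ↦ NormedSpace.exp (Complex.I • X e)) l (expUnitary x) := by
      refine ⟨⟨1, ?_⟩, fun a ha ↦ (hX.const_smul Complex.I).tendsto_exp_mul (mul_mem_range _) ha⟩
      filter_upwards [hexp] with e he
      obtain _ | _ := subsingleton_or_nontrivial 𝓜(ℂ, A)
      · simp [Subsingleton.elim _ (0 : 𝓜(ℂ, A))]
      · exact (CStarRing.norm_of_mem_unitary he.target_mem.2).le
    refine ⟨_, ?_, by simpa using hlim.mul hv' (mul_mem_range _)⟩
    filter_upwards [hexp, hv] with e he hve
    simpa using (he.mul hve).mono (Submonoid.coe_mul_self_eq _).subset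

lemma norm_mul_sub_unitary {B : Type*} [CStarAlgebra B] {u v : B} (hu : u ∈ unitary B)
    (hv : v ∈ unitary B) (b : B) :
    ‖b * (u - v)‖ = ‖(u - v) * (star u * star b)‖ := by
  have h : star (b * (u - v)) = -(star v * ((u - v) * (star u * star b))) := by
    have h₁ := (Unitary.mem_iff.mp hu).2
    have h₂ := (Unitary.mem_iff.mp hv).1
    simp [sub_mul, mul_sub, ← mul_assoc, h₁, h₂]
  rw [← norm_star, h, norm_neg, CStarRing.norm_mem_unitary_mul _ (Unitary.star_mem hv)]

end Multiplier

/-- Let `A` be a C*-algebra, `𝓜(ℂ, A)` its multiplier algebra and `Ã` the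
minimal unitization of `A`, i.e. the smallest unital (closed) C*-subalgebra of `𝓜(ℂ, A)`
containing the canonical image of `A`.  If `u` is a unitary of `𝓜(ℂ, A)` that is joined to
`1` by a path of unitaries (norm topology), then for every finite `F ⊆ A` and `ε > 0` there
is a unitary `v ∈ Ã`, joined to `1` by a path of unitaries of `Ã`, with `‖(u - v)·b‖ < ε`
and `‖b·(u - v)‖ < ε` for all `b ∈ F`; i.e. the identity component of the unitary group of
the minimal unitization is strictly dense in the identity component of the unitary group of
the multiplier algebra. -/
theorem unitary_pathComponent_minimalUnitization_strictly_dense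
    {A : Type*} [NonUnitalCStarAlgebra A]
    (Atilde : StarSubalgebra ℂ 𝓜(ℂ, A))
    (hAtilde : Atilde =
      (StarAlgebra.adjoin ℂ (Set.range ((↑) : A → 𝓜(ℂ, A)))).topologicalClosure)
    (u : 𝓜(ℂ, A)) (hu : u ∈ unitary 𝓜(ℂ, A))
    (hupath : JoinedIn (unitary 𝓜(ℂ, A) : Set 𝓜(ℂ, A)) 1 u)
    (F : Finset A) {ε : ℝ} (hε : 0 < ε) :
    ∃ v : 𝓜(ℂ, A), v ∈ Atilde ∧ v ∈ unitary 𝓜(ℂ, A) ∧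
      JoinedIn ((Atilde : Set 𝓜(ℂ, A)) ∩ (unitary 𝓜(ℂ, A) : Set 𝓜(ℂ, A))) 1 v ∧
      ∀ b ∈ F, ‖(u - v) * (b : 𝓜(ℂ, A))‖ < ε ∧ ‖(b : 𝓜(ℂ, A)) * (u - v)‖ < ε := by
  have hclosed : IsClosed (Atilde : Set 𝓜(ℂ, A)) :=
    hAtilde ▸ StarSubalgebra.isClosed_topologicalClosure _
  have hrange : Set.range ((↑) : A → 𝓜(ℂ, A)) ⊆ Atilde :=
    hAtilde ▸ (StarAlgebra.subset_adjoin ℂ _).trans (StarSubalgebra.le_topologicalClosure _)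
  obtain ⟨L, hL⟩ := Unitary.mem_pathComponentOne_iff.mp
    (show (⟨u, hu⟩ : unitary 𝓜(ℂ, A)) ∈ pathComponent 1 from hupath.joined_subtype)
  obtain ⟨l, _, hl, hl₁⟩ := exists_tendstoLeftStrict_coe_one A
  obtain ⟨v, hv, hvu⟩ := exists_tendstoLeftStrict_unitary hclosed hrange hl hl₁ L
  rw [hL] at hvu
  have small {a : 𝓜(ℂ, A)} (ha : a ∈ Set.range ((↑) : A → 𝓜(ℂ, A))) :
      ∀ᶠ e in l, ‖(u - v e) * a‖ < ε := by
    filter_upwards [(Metric.tendsto_nhds.mp (hvu.tendsto_mul a ha)) ε hε] with e he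
    rwa [sub_mul, ← dist_eq_norm, dist_comm]
  have hF : ∀ᶠ e in l, ∀ b ∈ F, ‖(u - v e) * (b : 𝓜(ℂ, A))‖ < ε ∧
      ‖(u - v e) * (star u * star (b : 𝓜(ℂ, A)))‖ < ε := by
    refine (Filter.eventually_all_finset F).mpr fun b _ ↦ (small ⟨b, rfl⟩).and (small ?_)
    exact DoubleCentralizer.mul_mem_range _ _ ⟨star b, (DoubleCentralizer.star_coe b).symm⟩
  obtain ⟨e, hve, hFe⟩ := (hv.and hF).exists
  obtain ⟨hmem, hunit⟩ := hve.target_mem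
  refine ⟨v e, hmem, hunit, hve, fun b hb ↦ ⟨(hFe b hb).1, ?_⟩⟩
  rw [norm_mul_sub_unitary hu hunit]
  exact (hFe b hb).2
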